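/- Let a ∈ [−1,1] with a ≠ 0, set α = aπ/2, and let H be the linear endomorphism of Λ₂ given by H = 2∂_{x`₁}∂_{x`₂} − (1/2)·(multiplication by x`₁x`₂) + id. Then the fractional Fourier transform F^a_{0|2} = exp(iαH) (the exponential of an endomorphism of the 4-dimensional complex space Λ₂) has the integral representation: for every g ∈ Λ₂, F^a_{0|2}(g)(y) = π(1 − e^{2iα}) ∫_{B,x} exp[ (2e^{iα}(y`₂x`₁ − y`₁x`₂) + (1 + e^{2iα})(x`₁x`₂ + y`₁y`₂)) / (2 − 2e^{2iα}) ] · g(x), an identity in the Grassmann algebra generated by y`₁, y`₂. -/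

import Mathlib

open scoped BigOperators
open Finset MeasureTheory

noncomputable section

/-- The Grassmann algebra on `N` anticommuting generators with coefficients in a
commutative ring `R`, represented by its coefficients with respect to the basis of
increasingly-ordered monomials, indexed by subsets of the generators. -/
abbrev Gr (R : Type) (N : ℕ) : Type := Finset (Fin N) → R

namespace Gr

variable {R : Type} [CommRing R] {N : ℕ}

/-- The sign produced when reordering the concatenation of the ordered monomials indexed
by `A` and `B` into the ordered monomial indexed by `A ∪ B`. -/
def msign (A B : Finset (Fin N)) : R :=
  (-1 : R) ^ (((A ×ˢ B).filter fun p => p.2 < p.1).card)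

/-- Multiplication of the Grassmann algebra. -/
def mul (f g : Gr R N) : Gr R N :=
  fun s => ∑ A ∈ s.powerset, msign A (s \ A) * f A * g (s \ A)

/-- The unit of the Grassmann algebra. -/
def one : Gr R N := fun s => if s = (∅ : Finset (Fin N)) then 1 else 0

/-- The `j`-th generator of the Grassmann algebra. -/
def gen (j : Fin N) : Gr R N := fun s => if s = {j} then 1 else 0

/-- Powers in the Grassmann algebra. -/
def pow (f : Gr R N) : ℕ → Gr R N
  | 0 => one
  | k + 1 => mul (pow f k) f

/-- The left partial derivative `∂_j`, i.e. the odd derivation with `∂_j(x_k) = δ_{jk}`. -/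
def pderiv (j : Fin N) (f : Gr R N) : Gr R N :=
  fun s => if j ∈ s then 0
    else (-1 : R) ^ ((s.filter fun i => i < j).card) * f (insert j s)

/-- The exponential of a Grassmann algebra element with nilpotent (zero-constant-term)
argument: the series terminates, and all terms beyond degree `N` vanish. -/
def gexp (f : Gr ℂ N) : Gr ℂ N :=
  ∑ k ∈ Finset.range (N + 1), ((k.factorial : ℂ))⁻¹ • pow f k

/-- Iterated left partial derivatives: the first element of the list acts first. -/
def derivList (l : List (Fin N)) (f : Gr R N) : Gr R N :=
  l.foldl (fun g j => pderiv j g) f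

/-- Complex conjugation of the coefficients. -/
def gconj (f : Gr ℂ N) : Gr ℂ N := fun s => (starRingEnd ℂ) (f s)

end Gr

/-- The Lean index of the paper's generator `x`_{2j-1}` (j = 1,…,n). -/
def lo (n : ℕ) (j : Fin n) : Fin (2 * n) := ⟨2 * (j : ℕ), by have := j.isLt; omega⟩

/-- The Lean index of the paper's generator `x`_{2j}` (j = 1,…,n). -/
def hi (n : ℕ) (j : Fin n) : Fin (2 * n) := ⟨2 * (j : ℕ) + 1, by have := j.isLt; omega⟩

/-- `x`² = Σ_{j=1}^n x`_{2j-1} x`_{2j}`. -/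
def xsq (n : ℕ) : Gr ℂ (2 * n) := ∑ j : Fin n, Gr.mul (Gr.gen (lo n j)) (Gr.gen (hi n j))

/-- The fermionic Laplace operator `Δ_f = 4 Σ_{j=1}^n ∂_{x`_{2j-1}} ∂_{x`_{2j}}`. -/
def lapF (n : ℕ) (f : Gr ℂ (2 * n)) : Gr ℂ (2 * n) :=
  (4 : ℂ) • ∑ j : Fin n, Gr.pderiv (lo n j) (Gr.pderiv (hi n j) f)

/-- The Berezin integral `∫_B = π^{-n} ∂_{x`_{2n}} ⋯ ∂_{x`_1}`. -/
def berezin (n : ℕ) (f : Gr ℂ (2 * n)) : ℂ :=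
  ((Real.pi : ℂ) ^ n)⁻¹ * Gr.derivList (List.finRange (2 * n)) f ∅

/-- The fermionic Gaussian `exp(x`²/2) = Σ_{j=0}^n (x`²)^j/(2^j j!)`. -/
def fermGauss (n : ℕ) : Gr ℂ (2 * n) :=
  ∑ j ∈ Finset.range (n + 1), (((2 : ℂ) ^ j * j.factorial)⁻¹) • Gr.pow (xsq n) j

/-- Embedding of the `x` generators into the Grassmann algebra on the `4n` generators
`x`_1, …, x`_{2n}, y`_1, …, y`_{2n}` (the `x` generators come first). -/
def xi (n : ℕ) (t : Fin (2 * n)) : Fin (2 * n + 2 * n) := Fin.castAdd (2 * n) t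

/-- Embedding of the `y` generators into the Grassmann algebra on the `4n` generators. -/
def yi (n : ℕ) (t : Fin (2 * n)) : Fin (2 * n + 2 * n) := Fin.natAdd (2 * n) t

/-- The algebra embedding `Λ_{2n} → Λ_{4n}` sending the generators to the `x` generators. -/
def embX (n : ℕ) (f : Gr ℂ (2 * n)) : Gr ℂ (2 * n + 2 * n) :=
  fun s => ∑ A : Finset (Fin (2 * n)), if s = A.image (xi n) then f A else 0

/-- The Berezin integral with respect to the `x` variables,
`π^{-n} ∂_{x`_{2n}} ⋯ ∂_{x`_1}`, inside the mixed algebra `Λ_{4n}`. -/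
def berezinX (n : ℕ) (F : Gr ℂ (2 * n + 2 * n)) : Gr ℂ (2 * n + 2 * n) :=
  ((Real.pi : ℂ) ^ n)⁻¹ • Gr.derivList ((List.finRange (2 * n)).map (xi n)) F

/-- The fermionic Fourier kernel
`K^σ(x, y) = exp(-σ (i/2) Σ_{j=1}^n (x`_{2j-1} y`_{2j} - x`_{2j} y`_{2j-1}))`
(for the plus sign `σ = 1`, for the minus sign `σ = -1`). -/
def fermK (n : ℕ) (σ : ℂ) : Gr ℂ (2 * n + 2 * n) :=
  Gr.gexp ((-σ * (Complex.I / 2)) • ∑ j : Fin n,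
    (Gr.mul (Gr.gen (xi n (lo n j))) (Gr.gen (yi n (hi n j))) -
     Gr.mul (Gr.gen (xi n (hi n j))) (Gr.gen (yi n (lo n j)))))

/-- The fermionic Fourier transform
`F^σ_{0|2n}(g)(y) = (2π)^n ∫_{B,x} K^σ(x,y) g(x)`, an element of the Grassmann algebra
in the `y` variables, identified with `Λ_{2n}`. -/
def fermFT (n : ℕ) (σ : ℂ) (g : Gr ℂ (2 * n)) : Gr ℂ (2 * n) :=
  fun s => (((2 * Real.pi : ℝ) : ℂ) ^ n) *
    berezinX n (Gr.mul (fermK n σ) (embX n g)) (s.image (yi n))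


end

noncomputable section

/-- The operator `H = 2 ∂_{x`₁}∂_{x`₂} - (1/2)·(multiplication by x`₁x`₂) + id` on
`Λ₂` (here `Λ₂ = Gr ℂ (2*1)`, with `x`₁ = gen (lo 1 0)` and `x`₂ = gen (hi 1 0)`). -/
def Hop (g : Gr ℂ (2 * 1)) : Gr ℂ (2 * 1) :=
  (2 : ℂ) • Gr.pderiv (lo 1 0) (Gr.pderiv (hi 1 0) g) -
    (1 / 2 : ℂ) • Gr.mul (Gr.mul (Gr.gen (lo 1 0)) (Gr.gen (hi 1 0))) g + g

/-- The fractional Fourier transform `F^a_{0|2} = exp(iαH)` with `α = aπ/2`: the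
exponential of the endomorphism `iαH` of the 4-dimensional complex space `Λ₂`,
given by its (convergent) exponential series. -/
def fracFT (α : ℝ) (g : Gr ℂ (2 * 1)) : Gr ℂ (2 * 1) :=
  ∑' k : ℕ, ((Complex.I * (α : ℂ)) ^ k * ((k.factorial : ℂ))⁻¹) • Hop^[k] g

/-- The kernel `exp[(2e^{iα}(y`₂x`₁ - y`₁x`₂) + (1+e^{2iα})(x`₁x`₂ + y`₁y`₂))/(2-2e^{2iα})]`
in the Grassmann algebra on the four anticommuting variables `x`₁, x`₂, y`₁, y`₂`. -/
def fracKer (α : ℝ) : Gr ℂ (2 * 1 + 2 * 1) :=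
  Gr.gexp ((2 - 2 * Complex.exp (2 * Complex.I * (α : ℂ)))⁻¹ •
    ((2 * Complex.exp (Complex.I * (α : ℂ))) •
        (Gr.mul (Gr.gen (yi 1 (hi 1 0))) (Gr.gen (xi 1 (lo 1 0))) -
         Gr.mul (Gr.gen (yi 1 (lo 1 0))) (Gr.gen (xi 1 (hi 1 0)))) +
      (1 + Complex.exp (2 * Complex.I * (α : ℂ))) •
        (Gr.mul (Gr.gen (xi 1 (lo 1 0))) (Gr.gen (xi 1 (hi 1 0))) +
         Gr.mul (Gr.gen (yi 1 (lo 1 0))) (Gr.gen (yi 1 (hi 1 0))))))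

namespace Gr

variable {R : Type} [CommRing R] {N : ℕ}

/-- The elements of the Grassmann algebra that are homogeneous of degree `m`. -/
def IsHomog (f : Gr R N) (m : ℕ) : Prop := ∀ s, s.card ≠ m → f s = 0

lemma IsHomog.mul {f g : Gr R N} {m n : ℕ} (hf : IsHomog f m) (hg : IsHomog g n) :
    IsHomog (Gr.mul f g) (m + n) := by
  intro s hs
  refine Finset.sum_eq_zero fun A hA => ?_
  have hc := Finset.card_sdiff_add_card_eq_card (Finset.mem_powerset.1 hA)
  by_cases h : A.card = m
  · rw [hg (s \ A) (by omega), mul_zero]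
  · rw [hf A h, mul_zero, zero_mul]

lemma IsHomog.pow {f : Gr R N} {m : ℕ} (hf : IsHomog f m) (k : ℕ) :
    IsHomog (Gr.pow f k) (k * m) := by
  induction k with
  | zero =>
    intro s hs
    have : s ≠ ∅ := by rintro rfl; simp at hs
    simp [Gr.pow, one, this]
  | succ k ih =>
    rw [Nat.succ_mul]
    exact ih.mul hf

lemma isHomog_gen (j : Fin N) : IsHomog (gen j : Gr R N) 1 := by
  intro s hs
  have : s ≠ {j} := by rintro rfl; simp at hs
  simp [gen, this]

lemma IsHomog.add {f g : Gr R N} {m : ℕ} (hf : IsHomog f m) (hg : IsHomog g m) :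
    IsHomog (f + g) m := fun s hs => by simp [hf s hs, hg s hs]

lemma IsHomog.sub {f g : Gr R N} {m : ℕ} (hf : IsHomog f m) (hg : IsHomog g m) :
    IsHomog (f - g) m := fun s hs => by simp [hf s hs, hg s hs]

lemma IsHomog.smul {f : Gr R N} {m : ℕ} (c : R) (hf : IsHomog f m) :
    IsHomog (c • f) m := fun s hs => by simp [hf s hs]

lemma one_mul' (f : Gr R N) : mul one f = f := by
  funext s
  unfold mul
  rw [Finset.sum_eq_single ∅]
  · simp [msign, one]
  · intro A _ hA
    simp [one, hA]
  · simp

/-- The product of two generators, with its coefficients in closed form. -/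
lemma gen_mul_gen {i j : Fin N} (h : i ≠ j) (s : Finset (Fin N)) :
    mul (gen i) (gen j) s = if s = {i, j} then (if j < i then (-1 : R) else 1) else 0 := by
  unfold mul
  split_ifs with hs hij
  · subst hs
    rw [Finset.sum_eq_single {i}]
    · have : ({i, j} : Finset (Fin N)) \ {i} = {j} := by
        ext x; simp; grind
      simp [this, gen, msign, Finset.filter_singleton, hij]
    · intro A _ hA
      simp [gen, hA]
    · simp
  · subst hs
    rw [Finset.sum_eq_single {i}]
    · have : ({i, j} : Finset (Fin N)) \ {i} = {j} := by
        ext x; simp; grind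
      simp [this, gen, msign, Finset.filter_singleton, hij]
    · intro A _ hA
      simp [gen, hA]
    · simp
  · refine Finset.sum_eq_zero fun A hA => ?_
    by_cases h1 : A = {i}
    · subst h1
      have : s \ {i} ≠ {j} := by
        intro h2
        apply hs
        rw [← Finset.sdiff_union_of_subset (Finset.mem_powerset.1 hA), h2, Finset.union_comm]
        rfl
      simp [gen, this]
    · simp [gen, h1]

/-- On four generators the exponential of a quadratic element stops at the second power. -/
lemma gexp_of_isHomog_two {f : Gr ℂ 4} (hf : IsHomog f 2) :
    gexp f = one + f + (1 / 2 : ℂ) • mul f f := by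
  have key : ∀ k, 3 ≤ k → pow f k = 0 := by
    intro k hk
    funext s
    refine hf.pow k s ?_
    have := s.card_le_univ
    simp at this
    omega
  simp [gexp, Finset.sum_range_succ, key 3, key 4]
  simp [pow, one_mul']

/-- The product as a sum over signed splittings, in a form that can be evaluated on
concrete sets of generators. -/
lemma mul_eq_sum_splittings (f g : Gr R N) (s : Finset (Fin N))
    (S : Finset (Finset (Fin N) × Finset (Fin N) × ℤ))
    (hS : s.powerset.image (fun A => (A, s \ A,
      (-1 : ℤ) ^ (((A ×ˢ (s \ A)).filter fun p => p.2 < p.1).card))) = S) :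
    mul f g s = ∑ p ∈ S, (p.2.2 : R) * f p.1 * g p.2.1 := by
  subst hS
  rw [Finset.sum_image fun A _ B _ h => congrArg Prod.fst h]
  simp [mul, msign]

lemma mul_empty (f g : Gr R N) : mul f g ∅ = f ∅ * g ∅ := by
  simp [mul, msign]

lemma mul_singleton (f g : Gr R N) (a : Fin N) :
    mul f g {a} = f ∅ * g {a} + f {a} * g ∅ := by
  rw [mul_eq_sum_splittings f g {a} {(∅, {a}, 1), ({a}, ∅, 1)}
    (by
      have h : ({a} : Finset (Fin N)).powerset = {∅, {a}} := by
        ext s; simp [Finset.subset_singleton_iff]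
      simp [h, Finset.image_insert]),
    Finset.sum_insert (by simp), Finset.sum_singleton]
  simp

lemma mul_zero_one_two (f g : Gr R 4) :
    mul f g {0, 1, 2} = f ∅ * g {0, 1, 2} + f {0} * g {1, 2} - f {1} * g {0, 2} +
      f {2} * g {0, 1} + f {0, 1} * g {2} - f {0, 2} * g {1} + f {1, 2} * g {0} +
      f {0, 1, 2} * g ∅ := by
  rw [mul_eq_sum_splittings f g _ {(∅, {0, 1, 2}, 1), ({0}, {1, 2}, 1), ({1}, {0, 2}, -1),
    ({2}, {0, 1}, 1), ({0, 1}, {2}, 1), ({0, 2}, {1}, -1), ({1, 2}, {0}, 1),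
    ({0, 1, 2}, ∅, 1)} (by decide)]
  repeat rw [Finset.sum_insert (by decide)]
  rw [Finset.sum_singleton]
  push_cast
  ring

lemma mul_zero_one_three (f g : Gr R 4) :
    mul f g {0, 1, 3} = f ∅ * g {0, 1, 3} + f {0} * g {1, 3} - f {1} * g {0, 3} +
      f {3} * g {0, 1} + f {0, 1} * g {3} - f {0, 3} * g {1} + f {1, 3} * g {0} +
      f {0, 1, 3} * g ∅ := by
  rw [mul_eq_sum_splittings f g _ {(∅, {0, 1, 3}, 1), ({0}, {1, 3}, 1), ({1}, {0, 3}, -1),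
    ({3}, {0, 1}, 1), ({0, 1}, {3}, 1), ({0, 3}, {1}, -1), ({1, 3}, {0}, 1),
    ({0, 1, 3}, ∅, 1)} (by decide)]
  repeat rw [Finset.sum_insert (by decide)]
  rw [Finset.sum_singleton]
  push_cast
  ring

lemma mul_zero_one (f g : Gr R 4) :
    mul f g {0, 1} = f ∅ * g {0, 1} + f {0} * g {1} - f {1} * g {0} + f {0, 1} * g ∅ := by
  rw [mul_eq_sum_splittings f g _ {(∅, {0, 1}, 1), ({0}, {1}, 1), ({1}, {0}, -1),
    ({0, 1}, ∅, 1)} (by decide)]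
  repeat rw [Finset.sum_insert (by decide)]
  rw [Finset.sum_singleton]
  push_cast
  ring

lemma mul_two_generators (f g : Gr R 2) :
    mul f g {0, 1} = f ∅ * g {0, 1} + f {0} * g {1} - f {1} * g {0} + f {0, 1} * g ∅ := by
  rw [mul_eq_sum_splittings f g _ {(∅, {0, 1}, 1), ({0}, {1}, 1), ({1}, {0}, -1),
    ({0, 1}, ∅, 1)} (by decide)]
  repeat rw [Finset.sum_insert (by decide)]
  rw [Finset.sum_singleton]
  push_cast
  ring

lemma mul_four_generators (f g : Gr R 4) :
    mul f g {0, 1, 2, 3} = f ∅ * g {0, 1, 2, 3} +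
      f {0} * g {1, 2, 3} - f {1} * g {0, 2, 3} + f {2} * g {0, 1, 3} - f {3} * g {0, 1, 2} +
      f {0, 1} * g {2, 3} - f {0, 2} * g {1, 3} + f {0, 3} * g {1, 2} +
      f {1, 2} * g {0, 3} - f {1, 3} * g {0, 2} + f {2, 3} * g {0, 1} +
      f {0, 1, 2} * g {3} - f {0, 1, 3} * g {2} + f {0, 2, 3} * g {1} - f {1, 2, 3} * g {0} +
      f {0, 1, 2, 3} * g ∅ := by
  rw [mul_eq_sum_splittings f g _ {(∅, {0, 1, 2, 3}, 1), ({0}, {1, 2, 3}, 1),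
    ({1}, {0, 2, 3}, -1), ({2}, {0, 1, 3}, 1), ({3}, {0, 1, 2}, -1), ({0, 1}, {2, 3}, 1),
    ({0, 2}, {1, 3}, -1), ({0, 3}, {1, 2}, 1), ({1, 2}, {0, 3}, 1), ({1, 3}, {0, 2}, -1),
    ({2, 3}, {0, 1}, 1), ({0, 1, 2}, {3}, 1), ({0, 1, 3}, {2}, -1), ({0, 2, 3}, {1}, 1),
    ({1, 2, 3}, {0}, -1), ({0, 1, 2, 3}, ∅, 1)} (by decide)]
  repeat rw [Finset.sum_insert (by decide)]
  rw [Finset.sum_singleton]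
  push_cast
  ring

end Gr

/-- Coefficients of the operator `H`. -/
lemma Hop_apply (g : Gr ℂ (2 * 1)) :
    Hop g ∅ = -2 * g {0, 1} + g ∅ ∧ Hop g {0} = g {0} ∧ Hop g {1} = g {1} ∧
      Hop g {0, 1} = -(1 / 2) * g ∅ + g {0, 1} := by
  have hl : lo 1 0 = 0 := rfl
  have hh : hi 1 0 = 1 := rfl
  have h01 : (0 : Fin (2 * 1)) ≠ 1 := by decide
  have hs : ({1, 0} : Finset (Fin (2 * 1))) = {0, 1} := by decide
  have hm : ∀ f g : Gr ℂ (2 * 1), Gr.mul f g {0, 1} =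
      f ∅ * g {0, 1} + f {0} * g {1} - f {1} * g {0} + f {0, 1} * g ∅ :=
    Gr.mul_two_generators
  have hx : (Gr.mul (Gr.gen 0) (Gr.gen 1) : Gr ℂ (2 * 1)) = _ :=
    funext (Gr.gen_mul_gen h01)
  refine ⟨?_, ?_, ?_, ?_⟩
  all_goals
    simp only [Hop, hl, hh, hx, Pi.add_apply, Pi.sub_apply, Pi.smul_apply, hm, Gr.mul_empty,
      Gr.mul_singleton]
    simp +decide [hs, Gr.pderiv, Finset.filter_singleton]

/-- Two elements of `Λ₂` agree when their four coefficients agree. -/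
lemma gr_two_ext {f g : Gr ℂ (2 * 1)} (h : f ∅ = g ∅) (h0 : f {0} = g {0})
    (h1 : f {1} = g {1}) (h01 : f {0, 1} = g {0, 1}) : f = g := by
  funext s
  have : ∀ s : Finset (Fin (2 * 1)), s = ∅ ∨ s = {0} ∨ s = {1} ∨ s = {0, 1} := by decide
  rcases this s with rfl | rfl | rfl | rfl <;> assumption

/-- The element of `Λ₂` with the given coefficients. -/
def grTwo (c c0 c1 c01 : ℂ) : Gr ℂ (2 * 1) := fun s =>
  if s = ∅ then c else if s = {0} then c0 else if s = {1} then c1 else c01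

lemma grTwo_empty (c c0 c1 c01 : ℂ) : grTwo c c0 c1 c01 ∅ = c := rfl

lemma grTwo_zero (c c0 c1 c01 : ℂ) : grTwo c c0 c1 c01 {0} = c0 := rfl

lemma grTwo_one (c c0 c1 c01 : ℂ) : grTwo c c0 c1 c01 {1} = c1 := rfl

lemma grTwo_zero_one (c c0 c1 c01 : ℂ) : grTwo c c0 c1 c01 {0, 1} = c01 := rfl

lemma Hop_grTwo (c c0 c1 c01 : ℂ) :
    Hop (grTwo c c0 c1 c01) = grTwo (c - 2 * c01) c0 c1 (c01 - c / 2) := by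
  obtain ⟨h, h0, h1, h01⟩ := Hop_apply (grTwo c c0 c1 c01)
  apply gr_two_ext
  · rw [h, grTwo_empty, grTwo_empty, grTwo_zero_one]; ring
  · rw [h0, grTwo_zero, grTwo_zero]
  · rw [h1, grTwo_one, grTwo_one]
  · rw [h01, grTwo_empty, grTwo_zero_one, grTwo_zero_one]; ring

/-- The powers of `H` through the spectral decomposition of `H`, with eigenvalues `0, 1, 2`. -/
lemma Hop_iterate (c c0 c1 c01 : ℂ) (k : ℕ) :
    Hop^[k] (grTwo c c0 c1 c01) =
      (0 : ℂ) ^ k • grTwo ((c + 2 * c01) / 2) 0 0 ((c + 2 * c01) / 4) +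
      ((1 : ℂ) ^ k • grTwo 0 c0 c1 0 +
      (2 : ℂ) ^ k • grTwo ((c - 2 * c01) / 2) 0 0 (-(c - 2 * c01) / 4)) := by
  have key : Hop^[k] (grTwo c c0 c1 c01) =
      grTwo (0 ^ k * ((c + 2 * c01) / 2) + 2 ^ k * ((c - 2 * c01) / 2)) c0 c1
        (0 ^ k * ((c + 2 * c01) / 4) - 2 ^ k * ((c - 2 * c01) / 4)) := by
    induction k with
    | zero =>
      apply gr_two_ext <;> simp only [Function.iterate_zero, id_eq, grTwo_empty, grTwo_zero,
        grTwo_one, grTwo_zero_one] <;> ring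
    | succ k ih =>
      rw [Function.iterate_succ_apply', ih, Hop_grTwo]
      apply gr_two_ext <;> simp only [grTwo_empty, grTwo_zero, grTwo_one, grTwo_zero_one] <;> ring
  rw [key]
  apply gr_two_ext <;> simp only [grTwo_empty, grTwo_zero, grTwo_one, grTwo_zero_one,
    Pi.add_apply, Pi.smul_apply, smul_eq_mul] <;> ring

lemma fracFT_grTwo (α : ℝ) (c c0 c1 c01 q : ℂ) (hq : q = Complex.exp (Complex.I * α)) :
    fracFT α (grTwo c c0 c1 c01) =
      grTwo ((1 + q ^ 2) / 2 * c + (1 - q ^ 2) * c01) (q * c0) (q * c1)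
        ((1 - q ^ 2) / 4 * c + (1 + q ^ 2) / 2 * c01) := by
  have hexp : ∀ (z : ℂ) (v : Gr ℂ (2 * 1)),
      HasSum (fun k : ℕ => ((Complex.I * (α : ℂ)) ^ k * ((k.factorial : ℂ))⁻¹) • z ^ k • v)
        (Complex.exp (Complex.I * α * z) • v) := by
    intro z v
    have h := NormedSpace.expSeries_div_hasSum_exp (Complex.I * α * z)
    rw [← Complex.exp_eq_exp_ℂ] at h
    refine (h.smul_const v).congr_fun ?_
    intro k
    rw [smul_smul, mul_pow]
    congr 1
    ring
  have hsum := (hexp 0 (grTwo ((c + 2 * c01) / 2) 0 0 ((c + 2 * c01) / 4))).add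
    ((hexp 1 (grTwo 0 c0 c1 0)).add
      (hexp 2 (grTwo ((c - 2 * c01) / 2) 0 0 (-(c - 2 * c01) / 4))))
  have h2 : Complex.exp (Complex.I * α * 2) = q ^ 2 := by
    rw [hq, ← Complex.exp_nat_mul]
    congr 1
    push_cast
    ring
  simp only [← smul_add, ← Hop_iterate, mul_zero, mul_one, Complex.exp_zero, ← hq, h2] at hsum
  rw [fracFT, hsum.tsum_eq]
  apply gr_two_ext <;> simp only [grTwo_empty, grTwo_zero, grTwo_one, grTwo_zero_one,
    Pi.add_apply, Pi.smul_apply, smul_eq_mul] <;> ring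

/-- The coefficients of the kernel. -/
lemma fracKer_apply (α : ℝ) (q : ℂ) (hq : q = Complex.exp (Complex.I * α))
    (h : 1 - q ^ 2 ≠ 0) (s : Finset (Fin 4)) :
    fracKer α s =
      if s = ∅ then 1
      else if s = {0, 1} ∨ s = {2, 3} then (1 + q ^ 2) / (2 * (1 - q ^ 2))
      else if s = {0, 3} then -(q / (1 - q ^ 2))
      else if s = {1, 2} then q / (1 - q ^ 2)
      else if s = {0, 1, 2, 3} then 1 / 4
      else 0 := by
  have h2 : Complex.exp (2 * Complex.I * α) = q ^ 2 := by
    rw [hq, ← Complex.exp_nat_mul]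
    congr 1
    push_cast
    ring
  set f : Gr ℂ 4 := (2 - 2 * q ^ 2)⁻¹ •
    ((2 * q) • (Gr.mul (Gr.gen 3) (Gr.gen 0) - Gr.mul (Gr.gen 2) (Gr.gen 1)) +
      (1 + q ^ 2) • (Gr.mul (Gr.gen 0) (Gr.gen 1) + Gr.mul (Gr.gen 2) (Gr.gen 3))) with hf
  have hK : fracKer α = Gr.gexp f := by
    rw [fracKer, h2, ← hq]
    rfl
  have hg : ∀ i j : Fin 4, Gr.IsHomog (Gr.mul (Gr.gen i) (Gr.gen j) : Gr ℂ 4) 2 :=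
    fun i j => (Gr.isHomog_gen i).mul (Gr.isHomog_gen j)
  have hf2 : Gr.IsHomog f 2 :=
    ((((hg 3 0).sub (hg 2 1)).smul _).add (((hg 0 1).add (hg 2 3)).smul _)).smul _
  have hfs : ∀ s, f s = if s = {0, 1} ∨ s = {2, 3} then (1 + q ^ 2) / (2 * (1 - q ^ 2))
      else if s = {0, 3} then -(q / (1 - q ^ 2))
      else if s = {1, 2} then q / (1 - q ^ 2) else 0 := by
    have hD : (2 - 2 * q ^ 2) = 2 * (1 - q ^ 2) := by ring
    intro s
    rw [hf, hD]
    simp only [Pi.smul_apply, Pi.add_apply, Pi.sub_apply, smul_eq_mul,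
      Gr.gen_mul_gen (show (3 : Fin 4) ≠ 0 by decide),
      Gr.gen_mul_gen (show (2 : Fin 4) ≠ 1 by decide),
      Gr.gen_mul_gen (show (0 : Fin 4) ≠ 1 by decide),
      Gr.gen_mul_gen (show (2 : Fin 4) ≠ 3 by decide)]
    have e1 : ({3, 0} : Finset (Fin 4)) = {0, 3} := by decide
    have e2 : ({2, 1} : Finset (Fin 4)) = {1, 2} := by decide
    rw [e1, e2]
    by_cases s1 : s = {0, 1}
    · subst s1; simp +decide; field_simp
    by_cases s2 : s = {2, 3}
    · subst s2; simp +decide; field_simp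
    by_cases s3 : s = {0, 3}
    · subst s3; simp +decide; field_simp
    by_cases s4 : s = {1, 2}
    · subst s4; simp +decide; field_simp
    simp [s1, s2, s3, s4]
  rw [hK, Gr.gexp_of_isHomog_two hf2]
  have hff : ∀ s, Gr.mul f f s = if s = {0, 1, 2, 3} then 1 / 2 else 0 := by
    intro s
    split_ifs with hs
    · subst hs
      rw [Gr.mul_four_generators]
      simp +decide [hfs]
      field_simp
      ring
    · refine hf2.mul hf2 s fun hc => hs ?_
      revert s
      decide
  simp only [Pi.add_apply, Pi.smul_apply, hff, hfs, Gr.one, smul_eq_mul]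
  revert s
  have hs : ∀ s : Finset (Fin 4), s = ∅ ∨ s = {0, 1} ∨ s = {2, 3} ∨ s = {0, 3} ∨ s = {1, 2} ∨
    s = {0, 1, 2, 3} ∨ (s ≠ ∅ ∧ s ≠ {0, 1} ∧ s ≠ {2, 3} ∧ s ≠ {0, 3} ∧ s ≠ {1, 2} ∧
    s ≠ {0, 1, 2, 3}) := by decide
  intro s
  rcases hs s with rfl | rfl | rfl | rfl | rfl | rfl | ⟨h1, h2, h3, h4, h5, h6⟩
  all_goals first | (simp +decide; done) | (simp +decide; norm_num; done) | simp [*]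

/-- The coefficients of the embedded function. -/
lemma embX_grTwo (c c0 c1 c01 : ℂ) (s : Finset (Fin 4)) :
    embX 1 (grTwo c c0 c1 c01) s =
      if s = ∅ then c else if s = {0} then c0 else if s = {1} then c1
      else if s = {0, 1} then c01 else 0 := by
  have hu : (Finset.univ : Finset (Finset (Fin (2 * 1)))) = {∅, {0}, {1}, {0, 1}} := by decide
  have i0 : ({0} : Finset (Fin (2 * 1))).image (xi 1) = ({0} : Finset (Fin 4)) := by decide
  have i1 : ({1} : Finset (Fin (2 * 1))).image (xi 1) = ({1} : Finset (Fin 4)) := by decide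
  have i01 : ({0, 1} : Finset (Fin (2 * 1))).image (xi 1) = ({0, 1} : Finset (Fin 4)) := by
    decide
  unfold embX
  rw [hu, Finset.sum_insert (by decide), Finset.sum_insert (by decide),
    Finset.sum_insert (by decide), Finset.sum_singleton, i0, i1, i01, Finset.image_empty]
  by_cases s1 : s = ∅
  · subst s1; simp +decide only [grTwo_empty, if_true, if_false, add_zero]
  by_cases s2 : s = {0}
  · subst s2; simp +decide only [grTwo_zero, if_true, if_false, add_zero, zero_add]
  by_cases s3 : s = {1}
  · subst s3; simp +decide only [grTwo_one, if_true, if_false, add_zero, zero_add]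
  by_cases s4 : s = {0, 1}
  · subst s4; simp +decide only [grTwo_zero_one, if_true, if_false, zero_add]
  simp [s1, s2, s3, s4]

/-- Coefficients of the partial Berezin integral in the `y` variables. -/
lemma berezinX_apply (F : Gr ℂ 4) :
    berezinX 1 F ∅ = (Real.pi : ℂ)⁻¹ * F {0, 1} ∧
      berezinX 1 F ({2} : Finset (Fin 4)) = (Real.pi : ℂ)⁻¹ * F {0, 1, 2} ∧
      berezinX 1 F ({3} : Finset (Fin 4)) = (Real.pi : ℂ)⁻¹ * F {0, 1, 3} ∧
      berezinX 1 F ({2, 3} : Finset (Fin 4)) = (Real.pi : ℂ)⁻¹ * F {0, 1, 2, 3} := by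
  have hl : (List.finRange (2 * 1)).map (xi 1) = [(0 : Fin 4), 1] := rfl
  have hb : ∀ s : Finset (Fin 4), berezinX 1 F s =
      (Real.pi : ℂ)⁻¹ * Gr.pderiv (1 : Fin 4) (Gr.pderiv (0 : Fin 4) F) s := by
    intro s
    simp only [berezinX, hl, pow_one]
    rfl
  have e : ∀ s : Finset (Fin 4), 0 ∉ s → 1 ∉ s →
      Gr.pderiv (1 : Fin 4) (Gr.pderiv (0 : Fin 4) F) s = F (insert 0 (insert 1 s)) := by
    intro s h0 h1
    have hc : (s.filter fun i => i = 0) = ∅ := by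
      revert s; decide
    simp [Gr.pderiv, h0, h1, hc]
  refine ⟨?_, ?_, ?_, ?_⟩
  all_goals
    rw [hb, e _ (by decide) (by decide)]
  rfl

/-- For `a ∈ [-1,1]`, `a ≠ 0`, and `α = aπ/2`, the fractional Fourier transform
`F^a_{0|2} = exp(iαH)` has the integral representation
`F^a_{0|2}(g)(y) = π(1-e^{2iα}) ∫_{B,x} exp[(2e^{iα}(y`₂x`₁ - y`₁x`₂)
  + (1+e^{2iα})(x`₁x`₂ + y`₁y`₂))/(2-2e^{2iα})] g(x)`. -/
theorem fracFT_integral_repr (a : ℝ) (ha : a ∈ Set.Icc (-1 : ℝ) 1) (ha0 : a ≠ 0)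
    (g : Gr ℂ (2 * 1)) :
    fracFT (a * Real.pi / 2) g = fun s =>
      ((Real.pi : ℂ) * (1 - Complex.exp (2 * Complex.I * ((a * Real.pi / 2 : ℝ) : ℂ)))) *
        berezinX 1 (Gr.mul (fracKer (a * Real.pi / 2)) (embX 1 g)) (s.image (yi 1)) := by
  set α : ℝ := a * Real.pi / 2 with hα
  set q := Complex.exp (Complex.I * α) with hq
  have h2 : Complex.exp (2 * Complex.I * α) = q ^ 2 := by
    rw [hq, ← Complex.exp_nat_mul]
    congr 1
    push_cast
    ring
  have hpi : (Real.pi : ℂ) ≠ 0 := by exact_mod_cast Real.pi_ne_zero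
  have h : 1 - q ^ 2 ≠ 0 := by
    intro h0
    have h1 : Complex.exp (2 * Complex.I * α) = 1 := by
      rw [h2]; linear_combination -h0
    obtain ⟨n, hn⟩ := Complex.exp_eq_one_iff.1 h1
    have hn' : (a : ℂ) = ((2 * n : ℤ) : ℂ) := by
      have : 2 * Complex.I * (Real.pi : ℂ) ≠ 0 := by simp [hpi]
      apply mul_left_cancel₀ this
      rw [hα] at hn
      push_cast at hn ⊢
      linear_combination 2 * hn
    have hr : a = ((2 * n : ℤ) : ℝ) := by exact_mod_cast hn'
    obtain ⟨l, u⟩ := ha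
    rw [hr] at l u
    have l' : (-1 : ℤ) ≤ 2 * n := by exact_mod_cast l
    have u' : 2 * n ≤ (1 : ℤ) := by exact_mod_cast u
    have : n = 0 := by omega
    exact ha0 (by rw [hr, this]; simp)
  obtain ⟨c, c0, c1, c01, rfl⟩ : ∃ c c0 c1 c01, g = grTwo c c0 c1 c01 :=
    ⟨g ∅, g {0}, g {1}, g {0, 1}, gr_two_ext rfl rfl rfl rfl⟩
  obtain ⟨b, b2, b3, b23⟩ :=
    berezinX_apply (Gr.mul (fracKer α) (embX 1 (grTwo c c0 c1 c01)))
  have i0 : ({0} : Finset (Fin (2 * 1))).image (yi 1) = ({2} : Finset (Fin 4)) := by decide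
  have i1 : ({1} : Finset (Fin (2 * 1))).image (yi 1) = ({3} : Finset (Fin 4)) := by decide
  have i01 : ({0, 1} : Finset (Fin (2 * 1))).image (yi 1) = ({2, 3} : Finset (Fin 4)) := by
    decide
  have hK := fracKer_apply α q hq h
  have hE := embX_grTwo c c0 c1 c01
  rw [fracFT_grTwo α c c0 c1 c01 q hq, h2]
  apply gr_two_ext
  · simp only [grTwo_empty, Finset.image_empty]
    rw [b, Gr.mul_zero_one]
    simp +decide [hK, hE]
    field_simp
    ring
  · simp only [grTwo_zero]
    rw [i0, b2, Gr.mul_zero_one_two]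
    simp +decide [hK, hE]
    field_simp
  · simp only [grTwo_one]
    rw [i1, b3, Gr.mul_zero_one_three]
    simp +decide [hK, hE]
    field_simp
  · simp only [grTwo_zero_one]
    rw [i01, b23, Gr.mul_four_generators]
    simp +decide [hK, hE]
    field_simp
    ring

end
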